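/- Let μ ∈ ℝ, σ > 0, p ∈ (0,1), α > 0, and let f be the GAL(μ,σ,p,α) density. Then the mean exists and equals ∫_ℝ y f(y) dy = μ + √(2/π)·ασ + σ(1−2p)/(p(1−p)). -/

import Mathlib

open MeasureTheory Real Set

/-- Standard normal CDF. -/
noncomputable def Phi (x : ℝ) : ℝ :=
  ∫ t in Set.Iic x, (Real.sqrt (2 * Real.pi))⁻¹ * Real.exp (-t ^ 2 / 2)

/-- The GAL(μ,σ,p,α) probability density function. -/
noncomputable def galPdf (μ σ p α y : ℝ) : ℝ :=
  let ys := (y - μ) / σ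
  let pp := p - (if 0 < α then 1 else 0)
  let pm := p - (if α < 0 then 1 else 0)
  (2 * p * (1 - p) / σ) *
    ((Phi (ys / α - α * pm) - Phi (-(α * pm))) *
        Real.exp (-(ys * pm) + (α * pm) ^ 2 / 2) *
        (if 0 < ys / α then 1 else 0) +
      Phi (α * pp - ys / α * (if 0 < ys / α then 1 else 0)) *
        Real.exp (-(ys * pp) + (α * pp) ^ 2 / 2))



open Filter Topology

/-- Standard normal density. -/
noncomputable def stdNormalPdf (x : ℝ) : ℝ :=
  (Real.sqrt (2 * Real.pi))⁻¹ * Real.exp (-x ^ 2 / 2)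

lemma stdNormalPdf_nonneg (x : ℝ) : 0 ≤ stdNormalPdf x := by
  unfold stdNormalPdf; positivity

lemma continuous_stdNormalPdf : Continuous stdNormalPdf := by
  unfold stdNormalPdf; fun_prop

lemma integrable_stdNormalPdf : Integrable stdNormalPdf := by
  refine ((integrable_exp_neg_mul_sq (b := 1 / 2) (by norm_num)).const_mul
    (Real.sqrt (2 * Real.pi))⁻¹).congr (.of_forall fun x => ?_)
  simp only [stdNormalPdf]
  congr 2
  ring

lemma integral_stdNormalPdf : ∫ x, stdNormalPdf x = 1 := by
  have h : ∀ x, stdNormalPdf x = (Real.sqrt (2 * Real.pi))⁻¹ * Real.exp (-(1 / 2) * x ^ 2) :=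
    fun x => by simp only [stdNormalPdf]; congr 2; ring
  simp_rw [h]
  rw [integral_const_mul, integral_gaussian, show π / (1 / 2) = 2 * π by ring]
  exact inv_mul_cancel₀ (by positivity)

lemma Phi_eq (x : ℝ) : Phi x = ∫ t in Iic x, stdNormalPdf t := rfl

lemma Phi_nonneg (x : ℝ) : 0 ≤ Phi x :=
  setIntegral_nonneg measurableSet_Iic fun t _ => stdNormalPdf_nonneg t

lemma Phi_le_one (x : ℝ) : Phi x ≤ 1 := by
  rw [Phi_eq, ← integral_stdNormalPdf]
  exact setIntegral_le_integral integrable_stdNormalPdf (.of_forall stdNormalPdf_nonneg)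

lemma monotone_Phi : Monotone Phi := fun _ _ h =>
  setIntegral_mono_set integrable_stdNormalPdf.integrableOn (.of_forall stdNormalPdf_nonneg)
    (Iic_subset_Iic.2 h).eventuallyLE

lemma Phi_zero : Phi 0 = 1 / 2 := by
  have h1 := integral_comp_neg_Iic (0 : ℝ) stdNormalPdf
  have h2 := intervalIntegral.integral_Iic_add_Ioi (b := (0 : ℝ))
    integrable_stdNormalPdf.integrableOn integrable_stdNormalPdf.integrableOn
  have h3 : ∀ x, stdNormalPdf (-x) = stdNormalPdf x := fun x => by simp [stdNormalPdf]
  simp_rw [h3, neg_zero] at h1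
  rw [integral_stdNormalPdf, ← h1, ← Phi_eq] at h2
  linarith

lemma hasDerivAt_Phi (x : ℝ) : HasDerivAt Phi (stdNormalPdf x) x := by
  have h : Phi = fun u => Phi 0 + ∫ t in (0 : ℝ)..u, stdNormalPdf t := by
    ext u
    rw [← intervalIntegral.integral_Iic_sub_Iic integrable_stdNormalPdf.integrableOn
      integrable_stdNormalPdf.integrableOn, ← Phi_eq, ← Phi_eq]
    ring
  rw [h]
  exact (intervalIntegral.integral_hasDerivAt_right
    (continuous_stdNormalPdf.intervalIntegrable _ _)
    continuous_stdNormalPdf.aestronglyMeasurable.stronglyMeasurableAtFilter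
    continuous_stdNormalPdf.continuousAt).const_add _

lemma hasDerivAt_stdNormalPdf (x : ℝ) :
    HasDerivAt stdNormalPdf (-x * stdNormalPdf x) x := by
  have h : HasDerivAt (fun x : ℝ => -x ^ 2 / 2) (-x) x := by
    convert! ((hasDerivAt_pow 2 x).neg.div_const 2) using 1
    simp
    ring
  convert! h.exp.const_mul (Real.sqrt (2 * Real.pi))⁻¹ using 1
  simp only [stdNormalPdf]; ring

lemma tendsto_Phi_atTop : Tendsto Phi atTop (𝓝 1) := by
  have h := (aecover_Iic (μ := volume) (tendsto_id (α := ℝ) (x := atTop))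
    ).integral_tendsto_of_countably_generated integrable_stdNormalPdf
  rwa [integral_stdNormalPdf] at h

lemma exists_Phi_le_mul_exp (k : ℝ) (hk : 0 ≤ k) : ∃ C, ∀ x, Phi x ≤ C * exp (k * x) := by
  have hint : Integrable fun t : ℝ => (Real.sqrt (2 * Real.pi))⁻¹ * exp (-(1 / 4) * t ^ 2) :=
    (integrable_exp_neg_mul_sq (by norm_num)).const_mul _
  refine ⟨(∫ t : ℝ, (Real.sqrt (2 * Real.pi))⁻¹ * exp (-(1 / 4) * t ^ 2)) * exp (k ^ 2),
    fun x => ?_⟩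
  rw [Phi_eq, mul_assoc, ← integral_mul_const]
  have hint' := hint.mul_const (exp (k ^ 2) * exp (k * x))
  refine (setIntegral_mono_on integrable_stdNormalPdf.integrableOn hint'.integrableOn
    measurableSet_Iic fun t ht => ?_).trans
      (setIntegral_le_integral hint' (.of_forall fun t => by positivity))
  rw [stdNormalPdf, mul_assoc, ← exp_add, ← exp_add]
  gcongr
  nlinarith [mul_nonneg hk (sub_nonneg.2 (mem_Iic.1 ht)), sq_nonneg (t / 2 + k)]

lemma tendsto_stdNormalPdf_atTop : Tendsto stdNormalPdf atTop (𝓝 0) := by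
  have h : Tendsto (fun x : ℝ => -x ^ 2 / 2) atTop atBot :=
    (tendsto_neg_atTop_atBot.comp (tendsto_pow_atTop (α := ℝ) two_ne_zero)).atBot_div_const
      (by norm_num)
  have h' := (tendsto_exp_atBot.comp h).const_mul (Real.sqrt (2 * Real.pi))⁻¹
  rwa [mul_zero] at h'

lemma tendsto_linear_mul_zero_of_le_exp {h : ℝ → ℝ} {c C : ℝ} (hc : 0 < c)
    (hh : ∀ t, 0 < t → |h t| ≤ C * exp (-(c * t))) (a b : ℝ) :
    Tendsto (fun t => (a * t + b) * h t) atTop (𝓝 0) := by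
  have hct : Tendsto (fun t : ℝ => c * t) atTop atTop := tendsto_id.const_mul_atTop hc
  have h1 := (tendsto_pow_mul_exp_neg_atTop_nhds_zero 1).comp hct
  have h0 := (tendsto_pow_mul_exp_neg_atTop_nhds_zero 0).comp hct
  refine squeeze_zero_norm' (a := fun t => |a| * C / c * ((c * t) ^ 1 * exp (-(c * t)))
    + |b| * C * ((c * t) ^ 0 * exp (-(c * t)))) ?_ ?_
  · filter_upwards [eventually_gt_atTop 0] with t ht
    rw [norm_mul, norm_eq_abs, norm_eq_abs]
    calc |a * t + b| * |h t| ≤ (|a| * t + |b|) * (C * exp (-(c * t))) := by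
          gcongr
          · exact (abs_add_le _ _).trans (by rw [abs_mul, abs_of_pos ht])
          · exact hh t ht
      _ = _ := by field_simp
  · simpa using! (h1.const_mul (|a| * C / c)).add (h0.const_mul (|b| * C))

lemma integrableOn_Iic_of_comp_neg {f : ℝ → ℝ} (h : IntegrableOn (fun x => f (-x)) (Ioi 0)) :
    IntegrableOn f (Iic 0) := by
  rw [integrableOn_Iic_iff_integrableOn_Iio]
  have := (Measure.measurePreserving_neg (volume : Measure ℝ)).integrableOn_comp_preimage
    (f := f) (s := Iio 0) (Homeomorph.neg ℝ).measurableEmbedding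
  rw [← this]
  simpa using! h

lemma integral_Ioi_linear_mul_exp_neg {c : ℝ} (hc : 0 < c) {a b : ℝ} (ha : 0 ≤ a) (hb : 0 ≤ b) :
    IntegrableOn (fun t => (a * t + b) * exp (-(c * t))) (Ioi 0) ∧
      ∫ t in Ioi 0, (a * t + b) * exp (-(c * t)) = a / c ^ 2 + b / c := by
  let G : ℝ → ℝ := fun t => (-(a / c) * t + (-(b / c) - a / c ^ 2)) * exp (-(c * t))
  have hG : ∀ t ∈ Ici (0 : ℝ), HasDerivAt G ((a * t + b) * exp (-(c * t))) t := fun t _ => by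
    have h1 : HasDerivAt (fun t => -(a / c) * t + (-(b / c) - a / c ^ 2)) (-(a / c)) t := by
      simpa using ((hasDerivAt_id t).const_mul (-(a / c))).add_const (-(b / c) - a / c ^ 2)
    have h2 : HasDerivAt (fun t => -(c * t)) (-c) t := by
      simpa using! ((hasDerivAt_id t).const_mul c).neg
    convert! h1.mul h2.exp using 1
    field_simp
    ring
  have hpos : ∀ t ∈ Ioi (0 : ℝ), 0 ≤ (a * t + b) * exp (-(c * t)) := fun t ht => by
    have := (mem_Ioi.1 ht).le
    positivity
  have hlim : Tendsto G atTop (𝓝 0) :=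
    tendsto_linear_mul_zero_of_le_exp (C := 1) hc (fun t _ => by simp) _ _
  refine ⟨integrableOn_Ioi_deriv_of_nonneg' hG hpos hlim, ?_⟩
  rw [integral_Ioi_of_hasDerivAt_of_nonneg' hG hpos hlim]
  simp only [G, mul_zero, neg_zero, exp_zero]
  ring

/-- The restriction of the standardized GAL density to `(0, ∞)`, up to the factor `2 * p * q`,
where `q = 1 - p`. -/
noncomputable def galRight (p q α t : ℝ) : ℝ :=
  (Phi (t / α - α * p) - Phi (-(α * p))) * exp (-(t * p) + (α * p) ^ 2 / 2) +
    Phi (-(α * q) - t / α) * exp (t * q + (α * q) ^ 2 / 2)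

lemma galRight_nonneg (p q : ℝ) {α t : ℝ} (hα : 0 < α) (ht : 0 ≤ t) : 0 ≤ galRight p q α t := by
  have h : Phi (-(α * p)) ≤ Phi (t / α - α * p) := monotone_Phi (by
    have : 0 ≤ t / α := by positivity
    linarith)
  have := Phi_nonneg (-(α * q) - t / α)
  have := sub_nonneg.2 h
  unfold galRight
  positivity

lemma stdNormalPdf_sub_mul_exp (p : ℝ) {α : ℝ} (hα : 0 < α) (t : ℝ) :
    stdNormalPdf (t / α - α * p) * exp (-(t * p) + (α * p) ^ 2 / 2) = stdNormalPdf (t / α) := by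
  rw [stdNormalPdf, stdNormalPdf, mul_assoc, ← exp_add]
  congr 2
  field_simp
  ring

lemma stdNormalPdf_neg_sub_mul_exp (q : ℝ) {α : ℝ} (hα : 0 < α) (t : ℝ) :
    stdNormalPdf (-(α * q) - t / α) * exp (t * q + (α * q) ^ 2 / 2) = stdNormalPdf (t / α) := by
  rw [stdNormalPdf, stdNormalPdf, mul_assoc, ← exp_add]
  congr 2
  field_simp
  ring

lemma integral_Ioi_linear_mul_galRight {p q α : ℝ} (hp : 0 < p) (hq : 0 < q) (hα : 0 < α)
    {a b : ℝ} (ha : 0 ≤ a) (hb : 0 ≤ b) :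
    IntegrableOn (fun t => (a * t + b) * galRight p q α t) (Ioi 0) ∧
      ∫ t in Ioi 0, (a * t + b) * galRight p q α t =
        (a / p ^ 2 - a / q ^ 2 + b / p + b / q) / 2
          + a * α * (1 / p + 1 / q) * (Real.sqrt (2 * π))⁻¹
          + (a / q ^ 2 - b / q) * (Phi (-(α * q)) * exp ((α * q) ^ 2 / 2)) := by
  let u : ℝ → ℝ := fun t =>
    (Phi (t / α - α * p) - Phi (-(α * p))) * exp (-(t * p) + (α * p) ^ 2 / 2)
  let v : ℝ → ℝ := fun t => Phi (-(α * q) - t / α) * exp (t * q + (α * q) ^ 2 / 2)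
  have hu : ∀ t, HasDerivAt u (stdNormalPdf (t / α) / α - p * u t) t := fun t => by
    have h1 : HasDerivAt (fun t => t / α - α * p) (1 / α) t :=
      ((hasDerivAt_id t).div_const α).sub_const _
    have h2 : HasDerivAt (fun t => -(t * p) + (α * p) ^ 2 / 2) (-p) t := by
      simpa using ((hasDerivAt_id t).mul_const p).neg.add_const ((α * p) ^ 2 / 2)
    convert! (((hasDerivAt_Phi _).comp t h1).sub_const (Phi (-(α * p)))).mul h2.exp using 1
    rw [← stdNormalPdf_sub_mul_exp p hα t]
    simp only [u, Function.comp_apply]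
    ring
  have hv : ∀ t, HasDerivAt v (-(stdNormalPdf (t / α) / α) + q * v t) t := fun t => by
    have h1 : HasDerivAt (fun t => -(α * q) - t / α) (-(1 / α)) t :=
      ((hasDerivAt_id t).div_const α).const_sub _
    have h2 : HasDerivAt (fun t => t * q + (α * q) ^ 2 / 2) q t := by
      simpa using ((hasDerivAt_id t).mul_const q).add_const ((α * q) ^ 2 / 2)
    convert! ((hasDerivAt_Phi _).comp t h1).mul h2.exp using 1
    rw [← stdNormalPdf_neg_sub_mul_exp q hα t]
    simp only [v, Function.comp_apply]
    ring
  let G : ℝ → ℝ := fun t =>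
    (-(a / p) * t + (-(a / p ^ 2) - b / p)) * u t + (a / q * t + (-(a / q ^ 2) + b / q)) * v t
      - a * α * (1 / p + 1 / q) * stdNormalPdf (t / α)
      + (a / p ^ 2 - a / q ^ 2 + b / p + b / q) * Phi (t / α)
  have hG : ∀ t ∈ Ici (0 : ℝ), HasDerivAt G ((a * t + b) * galRight p q α t) t := fun t _ => by
    have h0 : HasDerivAt (fun t => t / α) (1 / α) t := (hasDerivAt_id t).div_const α
    have hl : ∀ c d : ℝ, HasDerivAt (fun t => c * t + d) c t := fun c d => by
      simpa using ((hasDerivAt_id t).const_mul c).add_const d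
    convert! ((((hl _ _).mul (hu t)).add ((hl _ _).mul (hv t))).sub
      (((hasDerivAt_stdNormalPdf _).comp t h0).const_mul (a * α * (1 / p + 1 / q)))).add
      (((hasDerivAt_Phi _).comp t h0).const_mul (a / p ^ 2 - a / q ^ 2 + b / p + b / q)) using 1
    rw [show galRight p q α t = u t + v t from rfl]
    field_simp
    ring
  have hpos : ∀ t ∈ Ioi (0 : ℝ), 0 ≤ (a * t + b) * galRight p q α t := fun t ht => by
    have := (mem_Ioi.1 ht).le
    have := galRight_nonneg p q hα this
    positivity
  have hu0 : ∀ t, 0 < t → |u t| ≤ exp ((α * p) ^ 2 / 2) * exp (-(p * t)) := fun t _ => by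
    have := Phi_nonneg (t / α - α * p)
    have := Phi_nonneg (-(α * p))
    have := Phi_le_one (t / α - α * p)
    have := Phi_le_one (-(α * p))
    simp only [u]
    rw [← exp_add, abs_mul, abs_exp, show (α * p) ^ 2 / 2 + -(p * t)
      = -(t * p) + (α * p) ^ 2 / 2 by ring]
    refine mul_le_of_le_one_left (exp_pos _).le (abs_le.2 ⟨by linarith, by linarith⟩)
  obtain ⟨C, hC⟩ := exists_Phi_le_mul_exp (α * (q + 1)) (by positivity)
  have hv0 : ∀ t, 0 < t → |v t| ≤
      C * exp (-(α * (q + 1) * (α * q)) + (α * q) ^ 2 / 2) * exp (-(1 * t)) := fun t _ => by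
    simp only [v]
    rw [abs_mul, abs_exp, abs_of_nonneg (Phi_nonneg _)]
    refine (mul_le_mul_of_nonneg_right (hC _) (exp_pos _).le).trans_eq ?_
    rw [mul_assoc C, mul_assoc C, ← exp_add, ← exp_add]
    congr 2
    field_simp
    ring
  have hdiv : Tendsto (fun t : ℝ => t / α) atTop atTop := tendsto_id.atTop_div_const hα
  have hlim : Tendsto G atTop (𝓝 (a / p ^ 2 - a / q ^ 2 + b / p + b / q)) := by
    have h := (((tendsto_linear_mul_zero_of_le_exp hp hu0 (-(a / p)) (-(a / p ^ 2) - b / p)).add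
      (tendsto_linear_mul_zero_of_le_exp one_pos hv0 (a / q) (-(a / q ^ 2) + b / q))).sub
      ((tendsto_stdNormalPdf_atTop.comp hdiv).const_mul (a * α * (1 / p + 1 / q)))).add
      ((tendsto_Phi_atTop.comp hdiv).const_mul (a / p ^ 2 - a / q ^ 2 + b / p + b / q))
    rwa [mul_zero, mul_one, zero_add, sub_zero, zero_add] at h
  refine ⟨integrableOn_Ioi_deriv_of_nonneg' hG hpos hlim, ?_⟩
  rw [integral_Ioi_of_hasDerivAt_of_nonneg' hG hpos hlim]
  simp [G, u, v, Phi_zero, stdNormalPdf]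
  ring

lemma galPdf_eq_standard (μ α p : ℝ) {σ : ℝ} (y : ℝ) :
    galPdf μ σ p α y = galPdf 0 1 p α ((y - μ) / σ) / σ := by
  simp only [galPdf]
  simp only [sub_zero, div_one]
  ring

lemma galPdf_standard_of_pos (p : ℝ) {α t : ℝ} (hα : 0 < α) (ht : 0 < t) :
    galPdf 0 1 p α t = 2 * p * (1 - p) * galRight p (1 - p) α t := by
  have h : 0 < t / α := div_pos ht hα
  simp only [galPdf, galRight, sub_zero, div_one, hα, hα.not_gt, h, if_true, if_false, mul_one]
  ring_nf

lemma galPdf_standard_neg_of_pos (p : ℝ) {α t : ℝ} (hα : 0 < α) (ht : 0 < t) :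
    galPdf 0 1 p α (-t) = 2 * p * (1 - p) *
      (Phi (-(α * (1 - p))) * exp ((α * (1 - p)) ^ 2 / 2)) * exp (-((1 - p) * t)) := by
  have h : ¬ 0 < -t / α := not_lt.2 (div_nonpos_of_nonpos_of_nonneg (by linarith) hα.le)
  simp only [galPdf, sub_zero, div_one, hα, hα.not_gt, h, if_true, if_false, mul_zero]
  rw [mul_assoc _ _ (exp (-((1 - p) * t))), mul_assoc _ _ (exp (-((1 - p) * t))), ← exp_add]
  ring_nf

/-- The integral over `ℝ` of a function equal to `k * f` on `(0, ∞)` and whose reflection equals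
`k' * g` there. -/
lemma integrable_and_integral_of_halves {F f g : ℝ → ℝ} {k k' A B : ℝ}
    (hf : IntegrableOn f (Ioi 0) ∧ ∫ t in Ioi 0, f t = A)
    (hg : IntegrableOn g (Ioi 0) ∧ ∫ t in Ioi 0, g t = B)
    (hF : ∀ t ∈ Ioi (0 : ℝ), F t = k * f t) (hF' : ∀ t ∈ Ioi (0 : ℝ), F (-t) = k' * g t) :
    Integrable F ∧ ∫ t, F t = k * A + k' * B := by
  have hr : IntegrableOn F (Ioi 0) :=
    IntegrableOn.congr_fun (hf.1.const_mul k) (fun t ht => (hF t ht).symm) measurableSet_Ioi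
  have hl : IntegrableOn F (Iic 0) := integrableOn_Iic_of_comp_neg
    (IntegrableOn.congr_fun (hg.1.const_mul k') (fun t ht => (hF' t ht).symm) measurableSet_Ioi)
  refine ⟨?_, ?_⟩
  · rw [← integrableOn_univ, ← Iic_union_Ioi (a := (0 : ℝ))]
    exact hl.union hr
  · have h := integral_comp_neg_Ioi (0 : ℝ) F
    rw [neg_zero] at h
    rw [← intervalIntegral.integral_Iic_add_Ioi hl hr, ← h,
      setIntegral_congr_fun measurableSet_Ioi hF, setIntegral_congr_fun measurableSet_Ioi hF',
      integral_const_mul, integral_const_mul, hf.2, hg.2, add_comm]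

lemma integral_galPdf_standard {p α : ℝ} (hp : p ∈ Ioo (0 : ℝ) 1) (hα : 0 < α) :
    Integrable (galPdf 0 1 p α) ∧ ∫ t, galPdf 0 1 p α t = 1 := by
  have hq : 0 < 1 - p := sub_pos.2 hp.2
  have hp0 := hp.1
  obtain ⟨h, h'⟩ := integrable_and_integral_of_halves (F := galPdf 0 1 p α)
    (k := 2 * p * (1 - p))
    (k' := 2 * p * (1 - p) * (Phi (-(α * (1 - p))) * exp ((α * (1 - p)) ^ 2 / 2)))
    (integral_Ioi_linear_mul_galRight hp0 hq hα le_rfl zero_le_one)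
    (integral_Ioi_linear_mul_exp_neg hq le_rfl zero_le_one)
    (fun t ht => by rw [galPdf_standard_of_pos p hα ht, zero_mul, zero_add, one_mul])
    (fun t ht => by rw [galPdf_standard_neg_of_pos p hα ht, zero_mul, zero_add, one_mul])
  refine ⟨h, h'.trans ?_⟩
  field_simp
  ring

lemma integral_mul_galPdf_standard {p α : ℝ} (hp : p ∈ Ioo (0 : ℝ) 1) (hα : 0 < α) :
    Integrable (fun t => t * galPdf 0 1 p α t) ∧
      ∫ t, t * galPdf 0 1 p α t = Real.sqrt (2 / π) * α + (1 - 2 * p) / (p * (1 - p)) := by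
  have hq : 0 < 1 - p := sub_pos.2 hp.2
  have hp0 := hp.1
  obtain ⟨h, h'⟩ := integrable_and_integral_of_halves (F := fun t => t * galPdf 0 1 p α t)
    (k := 2 * p * (1 - p))
    (k' := -(2 * p * (1 - p) * (Phi (-(α * (1 - p))) * exp ((α * (1 - p)) ^ 2 / 2))))
    (integral_Ioi_linear_mul_galRight hp0 hq hα zero_le_one le_rfl)
    (integral_Ioi_linear_mul_exp_neg hq zero_le_one le_rfl)
    (fun t ht => by rw [galPdf_standard_of_pos p hα ht]; ring)
    (fun t ht => by rw [galPdf_standard_neg_of_pos p hα ht]; ring)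
  refine ⟨h, h'.trans ?_⟩
  have hsqrt : Real.sqrt (2 / π) = 2 * (Real.sqrt (2 * π))⁻¹ := by
    rw [← sqrt_inv, show (2 : ℝ) / π = 2 ^ 2 * (2 * π)⁻¹ by field_simp,
      sqrt_mul (by positivity), sqrt_sq (by norm_num)]
  rw [hsqrt]
  field_simp
  ring

/-- The mean of the GAL distribution exists and equals
μ + √(2/π)·ασ + σ(1−2p)/(p(1−p)). -/
theorem gal_mean (μ σ p α : ℝ) (hσ : 0 < σ) (hp : p ∈ Set.Ioo (0 : ℝ) 1)
    (hα : 0 < α) :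
    Integrable (fun y : ℝ => y * galPdf μ σ p α y) ∧
      (∫ y : ℝ, y * galPdf μ σ p α y) =
        μ + Real.sqrt (2 / Real.pi) * α * σ + σ * (1 - 2 * p) / (p * (1 - p)) := by
  obtain ⟨h0, h0'⟩ := integral_galPdf_standard hp hα
  obtain ⟨h1, h1'⟩ := integral_mul_galPdf_standard hp hα
  let F : ℝ → ℝ := fun t => t * galPdf 0 1 p α t + μ / σ * galPdf 0 1 p α t
  have hF : Integrable F := h1.add (h0.const_mul (μ / σ))
  have hy : (fun y => y * galPdf μ σ p α y) = fun y => F ((y - μ) / σ) := by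
    ext y
    rw [galPdf_eq_standard]
    simp only [F]
    field_simp
    ring
  rw [hy]
  refine ⟨(hF.comp_div hσ.ne').comp_sub_right μ, ?_⟩
  rw [integral_sub_right_eq_self (fun y => F (y / σ)) μ, Measure.integral_comp_div,
    integral_add h1 (h0.const_mul _), integral_const_mul, h0', h1', abs_of_pos hσ, smul_eq_mul]
  field_simp
  ring
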